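/- Let p ≥ q ≥ 1 and let A(h), h ∈ (0,1], be a family of real p×q matrices admitting a classical expansion A(h) ∼ Σ_{k≥0} h^k A_k, and assume all q singular values of A₀ are nonzero (equivalently A₀ᵀA₀ is positive definite). For 1 ≤ n ≤ q let μ_n(h) denote the n-th smallest singular value of A(h). Then for h small enough each μ_n(h) admits a classical expansion: there exist real numbers μ_n^k, k ≥ 0, such that for every N there is C_N with |μ_n(h) − Σ_{k=0}^N h^k μ_n^k| ≤ C_N h^{N+1} for all small h > 0, and μ_n^0 is the n-th smallest singular value of A₀. -/

import Mathlib

open Matrix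

attribute [local instance] Matrix.normedAddCommGroup

noncomputable section

namespace PowerSeriesMatrix

open PowerSeries

section FixedPoint

variable {R : Type*} [CommRing R] {m n : Type*}

/-- A matrix of power series whose entries are divisible by `X ^ k` is a multiple of `X ^ k`. -/
lemma exists_eq_X_pow_smul {A : Matrix m n R⟦X⟧} {k : ℕ}
    (h : ∀ i j, (X : R⟦X⟧) ^ k ∣ A i j) : ∃ E : Matrix m n R⟦X⟧, A = (X : R⟦X⟧) ^ k • E := by
  choose E hE using h
  exact ⟨Matrix.of E, by ext1 i j; simpa using hE i j⟩

lemma eq_zero_of_forall_X_pow_dvd {f : R⟦X⟧} (h : ∀ k : ℕ, (X : R⟦X⟧) ^ k ∣ f) : f = 0 := by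
  ext k
  simpa using PowerSeries.X_pow_dvd_iff.mp (h (k + 1)) k k.lt_succ_self

/-- An `X`-adic contraction of a space of matrices of power series has a unique fixed point. -/
lemma existsUnique_fixedPoint (Φ : Matrix m n R⟦X⟧ → Matrix m n R⟦X⟧)
    (hΦ : ∀ (k : ℕ) (A E : Matrix m n R⟦X⟧), ∃ E' : Matrix m n R⟦X⟧,
      Φ (A + (X : R⟦X⟧) ^ k • E) = Φ A + (X : R⟦X⟧) ^ (k + 1) • E') :
    ∃! Y, Y = Φ Y := by
  have hΦ' : ∀ (k : ℕ) (A B : Matrix m n R⟦X⟧), (∀ i j, (X : R⟦X⟧) ^ k ∣ A i j - B i j) →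
      ∀ i j, (X : R⟦X⟧) ^ (k + 1) ∣ Φ A i j - Φ B i j := by
    intro k A B h i j
    obtain ⟨E, hE⟩ := exists_eq_X_pow_smul (A := A - B) h
    obtain ⟨E', hE'⟩ := hΦ k B E
    rw [← hE, add_sub_cancel] at hE'
    exact ⟨E' i j, by simp [hE']⟩
  set it : ℕ → Matrix m n R⟦X⟧ := fun k => Φ^[k] 0 with hit
  have it_succ (k : ℕ) : it (k + 1) = Φ (it k) := Function.iterate_succ_apply' Φ k 0
  have step (k : ℕ) : ∀ i j, (X : R⟦X⟧) ^ k ∣ it (k + 1) i j - it k i j := by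
    induction k with
    | zero => simp
    | succ k ih =>
      rw [it_succ (k + 1), it_succ k]
      exact hΦ' k _ _ (by rw [← it_succ]; exact ih)
  set Y : Matrix m n R⟦X⟧ := Matrix.of fun i j => mk fun k => coeff k (it (k + 1) i j) with hY
  have coeff_stable (k l : ℕ) (h : k < l) (i : m) (j : n) :
      coeff k (it l i j) = coeff k (it (k + 1) i j) := by
    induction l, h using Nat.le_induction with
    | base => rfl
    | succ l hl ih =>
      rw [← ih]
      have := PowerSeries.X_pow_dvd_iff.mp (step l i j) k hl
      rwa [map_sub, sub_eq_zero] at this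
  have approx (k : ℕ) (i : m) (j : n) : (X : R⟦X⟧) ^ k ∣ Y i j - it k i j := by
    rw [PowerSeries.X_pow_dvd_iff]
    intro l hl
    simp [hY, coeff_stable l k hl]
  refine ⟨Y, ?_, ?_⟩
  · ext1 i j
    rw [← sub_eq_zero]
    refine eq_zero_of_forall_X_pow_dvd fun k => ?_
    have h1 := approx (k + 1) i j
    have h2 := hΦ' k _ _ (approx k) i j
    rw [it_succ] at h1
    have := dvd_sub h1 h2
    rw [sub_sub_sub_cancel_right] at this
    exact (pow_dvd_pow _ k.le_succ).trans this
  · intro Z hZ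
    have key (k : ℕ) : ∀ i j, (X : R⟦X⟧) ^ k ∣ Z i j - it k i j := by
      induction k with
      | zero => simp
      | succ k ih =>
        rw [it_succ, hZ]
        exact hΦ' k _ _ ih
    ext1 i j
    rw [← sub_eq_zero]
    refine eq_zero_of_forall_X_pow_dvd fun k => ?_
    have := dvd_sub (key k i j) (approx k i j)
    rwa [sub_sub_sub_cancel_right] at this

/-- A matrix equation of Riccati type with small nonconstant part has a unique solution in
matrices of power series. -/
lemma existsUnique_riccati [Fintype m] [Fintype n] (C : Matrix m n R⟦X⟧) (K : Matrix m m R⟦X⟧)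
    (P : Matrix n n R⟦X⟧) (Q : Matrix n m R⟦X⟧) :
    ∃! Y : Matrix m n R⟦X⟧, Y = C + (X : R⟦X⟧) • (K * (Y * P + Y * Q * Y)) := by
  refine existsUnique_fixedPoint _ fun k A E =>
    ⟨K * (E * P + E * Q * A + A * Q * E + (X : R⟦X⟧) ^ k • (E * Q * E)), ?_⟩
  have inner : (A + (X : R⟦X⟧) ^ k • E) * P + (A + (X : R⟦X⟧) ^ k • E) * Q *
      (A + (X : R⟦X⟧) ^ k • E) = (A * P + A * Q * A) +
        (X : R⟦X⟧) ^ k • (E * P + E * Q * A + A * Q * E + (X : R⟦X⟧) ^ k • (E * Q * E)) := by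
    generalize (X : R⟦X⟧) ^ k = x
    simp only [Matrix.add_mul, Matrix.mul_add, Matrix.smul_mul, Matrix.mul_smul, smul_add]
    abel
  rw [inner, Matrix.mul_add, smul_add, Matrix.mul_smul, smul_smul, pow_succ', ← add_assoc C]

lemma isUnit_of_isUnit_map_constantCoeff [Fintype n] [DecidableEq n] {A : Matrix n n R⟦X⟧}
    (h : IsUnit (A.map constantCoeff)) : IsUnit A := by
  rw [Matrix.isUnit_iff_isUnit_det] at h ⊢
  rw [PowerSeries.isUnit_iff_constantCoeff, RingHom.map_det]
  exact h

lemma exists_eq_X_smul {A : Matrix m n R⟦X⟧} (h : A.map constantCoeff = 0) :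
    ∃ E : Matrix m n R⟦X⟧, A = (X : R⟦X⟧) • E := by
  have := exists_eq_X_pow_smul (A := A) (k := 1) fun i j => by
    rw [pow_one, PowerSeries.X_dvd_iff]
    exact congrFun (congrFun h i) j
  simpa using this

lemma X_smul_left_injective {A B : Matrix m n R⟦X⟧} {k : ℕ}
    (h : (X : R⟦X⟧) ^ k • A = (X : R⟦X⟧) ^ k • B) : A = B := by
  ext i j l
  have := congrArg (coeff (l + k)) (congrFun (congrFun h i) j)
  simpa [PowerSeries.coeff_X_pow_mul] using this

/-- A nonzero matrix of power series is a power of `X` times a matrix with nonzero constant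
term. -/
lemma exists_eq_X_pow_smul_of_ne_zero {B : Matrix m n R⟦X⟧} (hB : B ≠ 0) :
    ∃ (k : ℕ) (E : Matrix m n R⟦X⟧), B = (X : R⟦X⟧) ^ k • E ∧ E.map constantCoeff ≠ 0 := by
  classical
  have hex : ∃ k : ℕ, ¬ ∀ i j, (X : R⟦X⟧) ^ k ∣ B i j := by
    by_contra! h
    exact hB (by ext1 i j; exact eq_zero_of_forall_X_pow_dvd fun k => h k i j)
  obtain ⟨k, hk⟩ : ∃ k, Nat.find hex = k + 1 := by
    refine Nat.exists_eq_succ_of_ne_zero fun h0 => ?_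
    have := Nat.find_spec hex
    rw [h0] at this
    simp at this
  have hdvd : ∀ i j, (X : R⟦X⟧) ^ k ∣ B i j :=
    not_not.mp (Nat.find_min hex (m := k) (by lia))
  obtain ⟨E, hE⟩ := exists_eq_X_pow_smul hdvd
  refine ⟨k, E, hE, fun h => ?_⟩
  obtain ⟨F, hF⟩ := exists_eq_X_smul h
  have := Nat.find_spec hex
  rw [hk] at this
  refine this fun i j => ⟨F i j, ?_⟩
  rw [hE, hF, smul_smul, ← pow_succ]
  rfl

end FixedPoint

section SquareRoot

variable {n : Type*} [Fintype n] [DecidableEq n]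

/-- A symmetric matrix of power series with identity constant term has a symmetric invertible
square root. -/
lemma exists_symm_sq (Y : Matrix n n ℝ⟦X⟧) (hY : Yᵀ = Y) :
    ∃ Z : Matrix n n ℝ⟦X⟧, Zᵀ = Z ∧
      (1 + (X : ℝ⟦X⟧) • Z) * (1 + (X : ℝ⟦X⟧) • Z) = 1 + (X : ℝ⟦X⟧) • Y := by
  obtain ⟨Z, hZ, huniq⟩ := existsUnique_riccati ((2⁻¹ : ℝ) • Y) 1 0 ((-2⁻¹ : ℝ) • 1)
  simp only [Matrix.mul_zero, zero_add, Matrix.one_mul, Matrix.mul_smul, Matrix.mul_one,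
    Matrix.smul_mul] at hZ huniq
  refine ⟨Z, huniq _ ?_, ?_⟩
  · conv_lhs => rw [hZ]
    simp [Matrix.transpose_add, Matrix.transpose_smul, Matrix.transpose_mul, hY]
  · have h2 : (2 : ℝ) • Z + (X : ℝ⟦X⟧) • (Z * Z) = Y := by
      conv_lhs => enter [1]; rw [hZ]
      rw [smul_add, smul_smul, smul_comm (2 : ℝ) (X : ℝ⟦X⟧), smul_smul]
      norm_num
    rw [← h2]
    simp only [Matrix.add_mul, Matrix.mul_add, Matrix.one_mul, Matrix.mul_one, Matrix.smul_mul,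
      Matrix.mul_smul, smul_add, two_smul]
    abel

/-- A symmetric matrix of power series with identity constant term is congruent to the identity. -/
lemma exists_congruence_one (Y : Matrix n n ℝ⟦X⟧) (hY : Yᵀ = Y) :
    ∃ T : Matrix n n ℝ⟦X⟧, Tᵀ * (1 + (X : ℝ⟦X⟧) • Y) * T = 1 := by
  obtain ⟨Z, hZ, hsq⟩ := exists_symm_sq Y hY
  set T := 1 + (X : ℝ⟦X⟧) • Z with hT
  have hTu : IsUnit T := by
    refine isUnit_of_isUnit_map_constantCoeff ?_
    have : T.map constantCoeff = 1 := by
      ext i j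
      simp [hT, Matrix.one_apply, apply_ite]
    rw [this]
    exact isUnit_one
  have hdet := (Matrix.isUnit_iff_isUnit_det T).mp hTu
  have hTt : Tᵀ = T := by simp [hT, hZ]
  refine ⟨T⁻¹, ?_⟩
  rw [← hsq, Matrix.transpose_nonsing_inv, hTt, ← Matrix.mul_assoc, Matrix.nonsing_inv_mul _ hdet,
    Matrix.one_mul, Matrix.mul_nonsing_inv _ hdet]

end SquareRoot

section Diagonalization

/-- A matrix of power series is orthogonally diagonalizable. -/
def OrthDiag {n : Type*} [Fintype n] [DecidableEq n] (S : Matrix n n ℝ⟦X⟧) : Prop :=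
  ∃ (W : Matrix n n ℝ⟦X⟧) (D : n → ℝ⟦X⟧), Wᵀ * W = 1 ∧ Wᵀ * S * W = diagonal D

variable {m n : Type*} [Fintype m] [DecidableEq m] [Fintype n] [DecidableEq n]

lemma OrthDiag.of_conj {S V : Matrix n n ℝ⟦X⟧} (hV : Vᵀ * V = 1) (h : OrthDiag (Vᵀ * S * V)) :
    OrthDiag S := by
  obtain ⟨W, D, hW, hD⟩ := h
  refine ⟨V * W, D, ?_, ?_⟩
  · rw [Matrix.transpose_mul, Matrix.mul_assoc, ← Matrix.mul_assoc Vᵀ, hV, Matrix.one_mul, hW]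
  · rw [← hD, Matrix.transpose_mul]
    simp only [Matrix.mul_assoc]

lemma OrthDiag.smul_one_add_smul {S : Matrix n n ℝ⟦X⟧} (h : OrthDiag S) (c x : ℝ⟦X⟧) :
    OrthDiag (c • (1 : Matrix n n ℝ⟦X⟧) + x • S) := by
  obtain ⟨W, D, hW, hD⟩ := h
  refine ⟨W, fun i => c + x * D i, hW, ?_⟩
  rw [Matrix.mul_add, Matrix.add_mul, Matrix.mul_smul, Matrix.mul_smul, Matrix.smul_mul,
    Matrix.smul_mul, Matrix.mul_one, hW, hD]
  ext1 i j
  by_cases hij : i = j <;> simp [hij]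

lemma OrthDiag.of_reindex {S : Matrix n n ℝ⟦X⟧} (e : m ≃ n) (h : OrthDiag (S.submatrix e e)) :
    OrthDiag S := by
  obtain ⟨W, D, hW, hD⟩ := h
  refine ⟨W.submatrix e.symm e.symm, D ∘ e.symm, ?_, ?_⟩
  · rw [Matrix.transpose_submatrix, Matrix.submatrix_mul_equiv, hW, Matrix.submatrix_one_equiv]
  · have : S = (S.submatrix e e).submatrix e.symm e.symm := by simp
    rw [this, Matrix.transpose_submatrix, Matrix.submatrix_mul_equiv, Matrix.submatrix_mul_equiv,
      hD, Matrix.submatrix_diagonal_equiv]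

lemma OrthDiag.fromBlocks {S₁ : Matrix m m ℝ⟦X⟧} {S₂ : Matrix n n ℝ⟦X⟧} (h₁ : OrthDiag S₁)
    (h₂ : OrthDiag S₂) : OrthDiag (Matrix.fromBlocks S₁ 0 0 S₂) := by
  obtain ⟨W₁, D₁, hW₁, hD₁⟩ := h₁
  obtain ⟨W₂, D₂, hW₂, hD₂⟩ := h₂
  refine ⟨Matrix.fromBlocks W₁ 0 0 W₂, Sum.elim D₁ D₂, ?_, ?_⟩ <;>
  simp [Matrix.fromBlocks_transpose, Matrix.fromBlocks_multiply, hW₁, hW₂, hD₁, hD₂]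

/-- A symmetric matrix of power series whose constant term has two blocks with disjoint spectra is
orthogonally block diagonalizable. -/
lemma exists_block_diagonalization (S : Matrix (m ⊕ n) (m ⊕ n) ℝ⟦X⟧) (hS : Sᵀ = S) (a : ℝ)
    (d : n → ℝ) (hd : ∀ i, d i ≠ a)
    (h0 : S.map constantCoeff = Matrix.fromBlocks (diagonal fun _ => a) 0 0 (diagonal d)) :
    ∃ (V : Matrix (m ⊕ n) (m ⊕ n) ℝ⟦X⟧) (S₁ : Matrix m m ℝ⟦X⟧) (S₂ : Matrix n n ℝ⟦X⟧),
      Vᵀ * V = 1 ∧ Vᵀ * S * V = Matrix.fromBlocks S₁ 0 0 S₂ := by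
  obtain ⟨P, hP⟩ : ∃ P : Matrix m m ℝ⟦X⟧,
      S.toBlocks₁₁ - PowerSeries.C a • 1 = (X : ℝ⟦X⟧) • P := by
    refine exists_eq_X_smul ?_
    ext i j
    have := congrFun (congrFun h0 (Sum.inl i)) (Sum.inl j)
    simp only [Matrix.map_apply, Matrix.fromBlocks_apply₁₁] at this
    by_cases hij : i = j <;> simp_all [Matrix.toBlocks₁₁]
  obtain ⟨Q, hQ⟩ : ∃ Q : Matrix m n ℝ⟦X⟧, S.toBlocks₁₂ = (X : ℝ⟦X⟧) • Q := by
    refine exists_eq_X_smul ?_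
    ext i j
    exact congrFun (congrFun h0 (Sum.inl i)) (Sum.inr j)
  set R : Matrix n n ℝ⟦X⟧ := S.toBlocks₂₂ - PowerSeries.C a • 1 with hR
  have hRu : IsUnit R := by
    refine isUnit_of_isUnit_map_constantCoeff ?_
    have : R.map constantCoeff = diagonal fun i => d i - a := by
      ext i j
      have := congrFun (congrFun h0 (Sum.inr i)) (Sum.inr j)
      simp only [Matrix.map_apply, Matrix.fromBlocks_apply₂₂] at this
      by_cases hij : i = j <;> simp_all [Matrix.toBlocks₂₂]
    rw [this, Matrix.isUnit_iff_isUnit_det, Matrix.det_diagonal, isUnit_iff_ne_zero,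
      Finset.prod_ne_zero_iff]
    exact fun i _ => sub_ne_zero.mpr (hd i)
  have hRdet := (Matrix.isUnit_iff_isUnit_det R).mp hRu
  have hSb : S = Matrix.fromBlocks (PowerSeries.C a • 1 + (X : ℝ⟦X⟧) • P) ((X : ℝ⟦X⟧) • Q)
      ((X : ℝ⟦X⟧) • Qᵀ) (PowerSeries.C a • 1 + R) := by
    have h21 : S.toBlocks₂₁ = (X : ℝ⟦X⟧) • Qᵀ := by
      rw [← Matrix.transpose_smul, ← hQ]
      ext1 i j
      exact congrFun (congrFun hS.symm (Sum.inr i)) (Sum.inl j)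
    rw [← hP, ← hQ, ← h21, hR, add_sub_cancel, add_sub_cancel, Matrix.fromBlocks_toBlocks]
  obtain ⟨Y, hY, -⟩ := existsUnique_riccati (-((X : ℝ⟦X⟧) • (R⁻¹ * Qᵀ))) R⁻¹ P Q
  have hRic : (X : ℝ⟦X⟧) • Qᵀ + R * Y = (X : ℝ⟦X⟧) • (Y * P + Y * Q * Y) := by
    conv_lhs => rw [hY]
    rw [Matrix.mul_add, Matrix.mul_neg, Matrix.mul_smul, Matrix.mul_smul,
      ← Matrix.mul_assoc R R⁻¹, ← Matrix.mul_assoc R R⁻¹, Matrix.mul_nonsing_inv _ hRdet,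
      Matrix.one_mul, Matrix.one_mul, add_neg_cancel_left]
  obtain ⟨Z, hZ⟩ : ∃ Z : Matrix n m ℝ⟦X⟧, Y = (X : ℝ⟦X⟧) • Z :=
    ⟨-(R⁻¹ * Qᵀ) + R⁻¹ * (Y * P + Y * Q * Y), by rw [smul_add, smul_neg, ← hY]⟩
  obtain ⟨T₁, hT₁⟩ := exists_congruence_one ((X : ℝ⟦X⟧) • (Zᵀ * Z)) (by simp)
  obtain ⟨T₂, hT₂⟩ := exists_congruence_one ((X : ℝ⟦X⟧) • (Z * Zᵀ)) (by simp)
  have hG₁ : 1 + (X : ℝ⟦X⟧) • (X : ℝ⟦X⟧) • (Zᵀ * Z) = 1 + Yᵀ * Y := by simp [hZ]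
  have hG₂ : 1 + (X : ℝ⟦X⟧) • (X : ℝ⟦X⟧) • (Z * Zᵀ) = 1 + Y * Yᵀ := by simp [hZ]
  rw [hG₁] at hT₁
  rw [hG₂] at hT₂
  set V := Matrix.fromBlocks 1 (-Yᵀ) Y 1 with hV
  have hVV : Vᵀ * V = Matrix.fromBlocks (1 + Yᵀ * Y) 0 0 (1 + Y * Yᵀ) := by
    simp [hV, Matrix.fromBlocks_transpose, Matrix.fromBlocks_multiply, add_comm]
  have h21 : (Vᵀ * S * V).toBlocks₂₁ = 0 := by
    rw [hV, hSb, Matrix.mul_assoc, Matrix.fromBlocks_transpose, Matrix.fromBlocks_multiply,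
      Matrix.fromBlocks_multiply, Matrix.toBlocks_fromBlocks₂₁]
    simp only [Matrix.mul_one, Matrix.transpose_neg, Matrix.transpose_transpose,
      Matrix.transpose_one, Matrix.one_mul, Matrix.add_mul, Matrix.smul_mul]
    rw [add_left_comm ((X : ℝ⟦X⟧) • Qᵀ), hRic]
    simp only [Matrix.mul_add, Matrix.neg_mul, Matrix.mul_smul, Matrix.mul_one, smul_add,
      smul_neg, Matrix.mul_assoc]
    abel
  have hMs : (Vᵀ * S * V)ᵀ = Vᵀ * S * V := by
    simp [Matrix.transpose_mul, hS, Matrix.mul_assoc]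
  have h12 : (Vᵀ * S * V).toBlocks₁₂ = 0 := by
    ext1 i j
    rw [← hMs]
    exact congrFun (congrFun h21 j) i
  refine ⟨V * Matrix.fromBlocks T₁ 0 0 T₂, T₁ᵀ * (Vᵀ * S * V).toBlocks₁₁ * T₁,
    T₂ᵀ * (Vᵀ * S * V).toBlocks₂₂ * T₂, ?_, ?_⟩
  · rw [Matrix.transpose_mul, Matrix.mul_assoc, ← Matrix.mul_assoc Vᵀ, hVV,
      Matrix.fromBlocks_transpose, Matrix.fromBlocks_multiply, Matrix.fromBlocks_multiply]
    simp [← Matrix.mul_assoc, hT₁, hT₂]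
  · have : (V * Matrix.fromBlocks T₁ 0 0 T₂)ᵀ * S * (V * Matrix.fromBlocks T₁ 0 0 T₂) =
        (Matrix.fromBlocks T₁ 0 0 T₂)ᵀ * (Vᵀ * S * V) * Matrix.fromBlocks T₁ 0 0 T₂ := by
      simp only [Matrix.transpose_mul, Matrix.mul_assoc]
    rw [this, ← Matrix.fromBlocks_toBlocks (Vᵀ * S * V), h12, h21, Matrix.fromBlocks_transpose,
      Matrix.fromBlocks_multiply, Matrix.fromBlocks_multiply]
    simp

lemma exists_orthogonal_diagonal (A : Matrix n n ℝ) (hA : Aᵀ = A) :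
    ∃ (U : Matrix n n ℝ) (d : n → ℝ), Uᵀ * U = 1 ∧ Uᵀ * A * U = diagonal d := by
  have hH : A.IsHermitian := by
    rw [Matrix.IsHermitian, Matrix.conjTranspose_eq_transpose_of_trivial, hA]
  have hU : (hH.eigenvectorUnitary : Matrix n n ℝ)ᵀ *
      (hH.eigenvectorUnitary : Matrix n n ℝ) = 1 := by
    have := Unitary.coe_star_mul_self hH.eigenvectorUnitary
    rwa [Matrix.star_eq_conjTranspose, Matrix.conjTranspose_eq_transpose_of_trivial] at this
  refine ⟨hH.eigenvectorUnitary, hH.eigenvalues, hU, ?_⟩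
  have := hH.spectral_theorem
  rw [Unitary.conjStarAlgAut_apply, Matrix.star_eq_conjTranspose,
    Matrix.conjTranspose_eq_transpose_of_trivial] at this
  conv_lhs => enter [1, 2]; rw [this]
  simp only [Matrix.mul_assoc, hU, Matrix.mul_one]
  rw [← Matrix.mul_assoc, hU, Matrix.one_mul]
  rfl

/-- Splitting off a maximal cluster of equal eigenvalues of the constant term. -/
lemma exists_conj_submatrix_eq_fromBlocks (S : Matrix n n ℝ⟦X⟧) (hS : Sᵀ = S) (i₀ : n)
    (h00 : constantCoeff (S i₀ i₀) = 0) (h0 : S.map constantCoeff ≠ 0) :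
    ∃ (p : n → Prop) (_ : DecidablePred p) (V : Matrix n n ℝ⟦X⟧)
      (S₁ : Matrix {i // p i} {i // p i} ℝ⟦X⟧) (S₂ : Matrix {i // ¬ p i} {i // ¬ p i} ℝ⟦X⟧),
      (∃ i, p i) ∧ (∃ i, ¬ p i) ∧ Vᵀ * V = 1 ∧
      (Vᵀ * S * V).submatrix (Equiv.sumCompl p) (Equiv.sumCompl p) =
        Matrix.fromBlocks S₁ 0 0 S₂ := by
  classical
  obtain ⟨U, d, hU, hd⟩ := exists_orthogonal_diagonal (S.map constantCoeff) (by
    conv_rhs => rw [← hS]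
    rfl)
  have hU' : U * Uᵀ = 1 := mul_eq_one_comm.mp hU
  have hne : ∃ i, d i ≠ d i₀ := by
    by_contra! hcon
    have hdiag : diagonal d = d i₀ • (1 : Matrix n n ℝ) := by
      ext i j
      by_cases hij : i = j <;> simp [hij, hcon]
    have hSc : S.map constantCoeff = d i₀ • (1 : Matrix n n ℝ) := by
      calc S.map constantCoeff = (U * Uᵀ) * S.map constantCoeff * (U * Uᵀ) := by simp [hU']
        _ = U * (Uᵀ * S.map constantCoeff * U) * Uᵀ := by simp only [Matrix.mul_assoc]
        _ = d i₀ • (1 : Matrix n n ℝ) := by simp [hd, hdiag, hU']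
    have := congrFun (congrFun hSc i₀) i₀
    simp only [Matrix.map_apply, h00, Matrix.smul_apply, Matrix.one_apply_eq, smul_eq_mul,
      mul_one] at this
    exact h0 (by rw [hSc, ← this, zero_smul])
  set p : n → Prop := fun i => d i = d i₀ with hp
  set e := Equiv.sumCompl p with he
  set V₀ : Matrix n n ℝ⟦X⟧ := U.map PowerSeries.C with hV₀
  have hV₀t : V₀ᵀ = Uᵀ.map PowerSeries.C := rfl
  have hV₀V₀ : V₀ᵀ * V₀ = 1 := by
    rw [hV₀t, hV₀, ← Matrix.map_mul, hU, Matrix.map_one _ (map_zero _) (map_one _)]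
  have hCC (B : Matrix n n ℝ) : (B.map PowerSeries.C).map constantCoeff = B := by
    ext; simp
  have hmap : (V₀ᵀ * S * V₀).map constantCoeff = diagonal d := by
    rw [Matrix.map_mul, Matrix.map_mul, hV₀t, hCC, hV₀, hCC, hd]
  obtain ⟨V, S₁, S₂, hV, hVS⟩ := exists_block_diagonalization ((V₀ᵀ * S * V₀).submatrix e e)
    (by simp [Matrix.transpose_submatrix, Matrix.transpose_mul, hS, Matrix.mul_assoc])
    (d i₀) (fun i => d i.1) (fun i => i.2) (by
      rw [← Matrix.submatrix_map, hmap]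
      rw [Matrix.submatrix_diagonal_equiv, Matrix.fromBlocks_diagonal]
      congr 1
      ext (i | i)
      · simpa [e] using i.2
      · simp [e])
  refine ⟨p, inferInstance, V₀ * V.submatrix e.symm e.symm, S₁, S₂, ⟨i₀, rfl⟩, hne, ?_, ?_⟩
  · rw [Matrix.transpose_mul, Matrix.mul_assoc, ← Matrix.mul_assoc V₀ᵀ, hV₀V₀, Matrix.one_mul,
      Matrix.transpose_submatrix, Matrix.submatrix_mul_equiv, hV, Matrix.submatrix_one_equiv]
  · rw [← hVS]
    have h1 : (V₀ * V.submatrix e.symm e.symm)ᵀ * S * (V₀ * V.submatrix e.symm e.symm) =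
        (V.submatrix e.symm e.symm)ᵀ * (V₀ᵀ * S * V₀) * V.submatrix e.symm e.symm := by
      simp only [Matrix.transpose_mul, Matrix.mul_assoc]
    have h2 : V₀ᵀ * S * V₀ = ((V₀ᵀ * S * V₀).submatrix e e).submatrix e.symm e.symm := by simp
    rw [h1, h2, Matrix.transpose_submatrix, Matrix.submatrix_mul_equiv,
      Matrix.submatrix_mul_equiv, Matrix.submatrix_submatrix, ← he, Equiv.symm_comp_self,
      Matrix.submatrix_id_id]
    simp

/-- **Formal spectral theorem**: a symmetric matrix of real power series is orthogonally
diagonalizable over the ring of power series. -/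
theorem orthDiag_of_symm {n : Type*} [Fintype n] [DecidableEq n] (S : Matrix n n ℝ⟦X⟧)
    (hS : Sᵀ = S) : OrthDiag S := by
  classical
  induction hN : Fintype.card n using Nat.strong_induction_on generalizing n with
  | _ N ih =>
  rcases isEmpty_or_nonempty n with hn | ⟨⟨i₀⟩⟩
  · exact ⟨1, 0, by simp, Matrix.ext fun i => hn.elim i⟩
  by_cases hB : S - S i₀ i₀ • 1 = 0
  · rw [sub_eq_zero] at hB
    refine ⟨1, fun _ => S i₀ i₀, by simp, ?_⟩
    rw [Matrix.transpose_one, Matrix.one_mul, Matrix.mul_one]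
    conv_lhs => rw [hB]
    rw [Matrix.smul_one_eq_diagonal]
  obtain ⟨k, E, hE, hE0⟩ := exists_eq_X_pow_smul_of_ne_zero hB
  have hEs : Eᵀ = E := by
    refine X_smul_left_injective (k := k) ?_
    rw [← Matrix.transpose_smul, ← hE]
    simp [hS]
  have hE00 : E i₀ i₀ = 0 := by
    have := congrFun (congrFun hE i₀) i₀
    simpa using this.symm
  rw [sub_eq_iff_eq_add'] at hE
  rw [hE]
  refine OrthDiag.smul_one_add_smul ?_ _ _
  obtain ⟨p, _, V, S₁, S₂, ⟨i₁, h₁⟩, ⟨i₂, h₂⟩, hV, hVE⟩ :=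
    exists_conj_submatrix_eq_fromBlocks E hEs i₀ (by simp [hE00]) hE0
  refine OrthDiag.of_conj hV (OrthDiag.of_reindex (Equiv.sumCompl p) ?_)
  have hsymm : (Matrix.fromBlocks S₁ 0 0 S₂)ᵀ = Matrix.fromBlocks S₁ 0 0 S₂ := by
    rw [← hVE]
    simp [Matrix.transpose_submatrix, Matrix.transpose_mul, hEs, Matrix.mul_assoc]
  rw [Matrix.fromBlocks_transpose, Matrix.fromBlocks_inj] at hsymm
  rw [hVE]
  refine OrthDiag.fromBlocks (ih _ ?_ S₁ hsymm.1 rfl) (ih _ ?_ S₂ hsymm.2.2.2 rfl)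
  · rw [← hN]
    exact Fintype.card_subtype_lt (x := i₂) h₂
  · rw [← hN]
    exact Fintype.card_subtype_lt (x := i₁) (not_not.mpr h₁)

end Diagonalization

section Expansion

open Filter Topology Asymptotics

/-- `f h` agrees with the power series `φ` up to an error `O(h ^ (N + 1))` as `h → 0⁺`. -/
def ExpandsTo (N : ℕ) (f : ℝ → ℝ) (φ : ℝ⟦X⟧) : Prop :=
  (fun h => f h - (trunc (N + 1) φ).eval h) =O[𝓝[>] 0] fun h => h ^ (N + 1)

variable {N : ℕ} {f g : ℝ → ℝ} {φ ψ : ℝ⟦X⟧}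

lemma eval_trunc_eq_sum_range (n : ℕ) (φ : ℝ⟦X⟧) (h : ℝ) :
    (trunc n φ).eval h = ∑ k ∈ Finset.range n, h ^ k * coeff k φ := by
  rw [← Polynomial.eval₂_id, PowerSeries.eval₂_trunc_eq_sum_range]
  simp [mul_comm]

lemma tendsto_eval_trunc (N : ℕ) (φ : ℝ⟦X⟧) :
    Tendsto (fun h => (trunc (N + 1) φ).eval h) (𝓝[>] 0) (𝓝 (constantCoeff φ)) := by
  have := (trunc (N + 1) φ).continuous.tendsto 0
  rw [← Polynomial.coeff_zero_eq_eval_zero, PowerSeries.coeff_trunc, if_pos N.succ_pos] at this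
  rw [← PowerSeries.coeff_zero_eq_constantCoeff_apply]
  exact this.mono_left nhdsWithin_le_nhds

lemma isBigO_eval_trunc (N : ℕ) (φ : ℝ⟦X⟧) :
    (fun h => (trunc (N + 1) φ).eval h) =O[𝓝[>] 0] fun _ => (1 : ℝ) :=
  (tendsto_eval_trunc N φ).isBigO_one ℝ

lemma ExpandsTo.eval_trunc (N : ℕ) (φ : ℝ⟦X⟧) :
    ExpandsTo N (fun h => (trunc (N + 1) φ).eval h) φ := by
  simp [ExpandsTo, Asymptotics.isBigO_zero]

lemma ExpandsTo.isBigO_one (hf : ExpandsTo N f φ) : f =O[𝓝[>] 0] fun _ => (1 : ℝ) := by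
  have h1 : (fun h : ℝ => h ^ (N + 1)) =O[𝓝[>] 0] fun _ => (1 : ℝ) :=
    (((continuous_pow (N + 1)).tendsto (0 : ℝ)).mono_left nhdsWithin_le_nhds).isBigO_one ℝ
  simpa using (IsBigO.trans hf h1).add (isBigO_eval_trunc N φ)

lemma ExpandsTo.zero : ExpandsTo N (fun _ => 0) 0 := by
  simp [ExpandsTo, Asymptotics.isBigO_zero]

lemma ExpandsTo.add (hf : ExpandsTo N f φ) (hg : ExpandsTo N g ψ) :
    ExpandsTo N (fun h => f h + g h) (φ + ψ) := by
  refine (IsBigO.add hf hg).congr_left fun h => ?_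
  rw [map_add, Polynomial.eval_add]
  ring

lemma ExpandsTo.sum {ι : Type*} (s : Finset ι) {f : ι → ℝ → ℝ} {φ : ι → ℝ⟦X⟧}
    (hf : ∀ i ∈ s, ExpandsTo N (f i) (φ i)) :
    ExpandsTo N (fun h => ∑ i ∈ s, f i h) (∑ i ∈ s, φ i) := by
  classical
  induction s using Finset.induction_on with
  | empty => simpa using ExpandsTo.zero
  | insert i s hi ih =>
    simp only [Finset.sum_insert hi]
    exact (hf i (s.mem_insert_self i)).add (ih fun j hj => hf j (Finset.mem_insert_of_mem hj))

lemma isBigO_eval_trunc_mul (N : ℕ) (φ ψ : ℝ⟦X⟧) :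
    (fun h => (trunc (N + 1) φ).eval h * (trunc (N + 1) ψ).eval h -
      (trunc (N + 1) (φ * ψ)).eval h) =O[𝓝[>] 0] fun h => h ^ (N + 1) := by
  obtain ⟨r, hr⟩ : (Polynomial.X : Polynomial ℝ) ^ (N + 1) ∣
      trunc (N + 1) φ * trunc (N + 1) ψ - trunc (N + 1) (φ * ψ) := by
    rw [Polynomial.X_pow_dvd_iff]
    intro d hd
    rw [Polynomial.coeff_sub, PowerSeries.coeff_trunc, if_pos hd,
      PowerSeries.coeff_mul_eq_coeff_trunc_mul_trunc φ ψ hd, ← Polynomial.coe_mul,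
      Polynomial.coeff_coe, sub_self]
  have hr' : (fun h => r.eval h) =O[𝓝[>] 0] fun _ => (1 : ℝ) :=
    ((r.continuous.tendsto 0).mono_left nhdsWithin_le_nhds).isBigO_one ℝ
  refine ((isBigO_refl (fun h : ℝ => h ^ (N + 1)) _).mul hr').congr (fun h => ?_) fun h => mul_one _
  rw [← Polynomial.eval_mul, ← Polynomial.eval_sub, hr]
  simp

lemma ExpandsTo.mul (hf : ExpandsTo N f φ) (hg : ExpandsTo N g ψ) :
    ExpandsTo N (fun h => f h * g h) (φ * ψ) := by
  have h1 := (IsBigO.mul hf hg.isBigO_one).congr_right (g₂ := fun h => h ^ (N + 1))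
    fun h => mul_one _
  have h2 := ((isBigO_eval_trunc N φ).mul hg).congr_right (g₂ := fun h => h ^ (N + 1))
    fun h => one_mul _
  refine ((h1.add h2).add (isBigO_eval_trunc_mul N φ ψ)).congr_left fun h => ?_
  ring

lemma ExpandsTo.matrix_mul {l m n : Type*} [Fintype m] {A : ℝ → Matrix l m ℝ}
    {B : ℝ → Matrix m n ℝ} {A' : Matrix l m ℝ⟦X⟧} {B' : Matrix m n ℝ⟦X⟧}
    (hA : ∀ i j, ExpandsTo N (fun h => A h i j) (A' i j))
    (hB : ∀ i j, ExpandsTo N (fun h => B h i j) (B' i j)) (i : l) (j : n) :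
    ExpandsTo N (fun h => (A h * B h) i j) ((A' * B') i j) :=
  ExpandsTo.sum _ fun k _ => (hA i k).mul (hB k j)

lemma exists_sq_eq (φ : ℝ⟦X⟧) (hφ : 0 < constantCoeff φ) :
    ∃ ψ : ℝ⟦X⟧, ψ * ψ = φ ∧ 0 < constantCoeff ψ := by
  set c := constantCoeff φ with hc
  obtain ⟨y, hy⟩ : (X : ℝ⟦X⟧) ∣ PowerSeries.C c⁻¹ * φ - 1 := by
    rw [PowerSeries.X_dvd_iff]
    simp [← hc, hφ.ne']
  obtain ⟨Z, -, hZ⟩ := exists_symm_sq (n := Unit) (Matrix.of fun _ _ => y) rfl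
  have hz := congrFun (congrFun hZ ()) ()
  simp only [Matrix.mul_apply, Matrix.add_apply, Matrix.one_apply_eq, Matrix.smul_apply,
    smul_eq_mul, Finset.univ_unique, Finset.sum_singleton, Matrix.of_apply] at hz
  refine ⟨PowerSeries.C (√c) * (1 + X * Z () ()), ?_, ?_⟩
  · rw [mul_mul_mul_comm, ← map_mul, Real.mul_self_sqrt hφ.le]
    erw [hz]
    rw [← hy, add_sub_cancel, ← mul_assoc, ← map_mul, mul_inv_cancel₀ hφ.ne', map_one, one_mul]
  · simpa using hφ

lemma ExpandsTo.sqrt (hf : ExpandsTo N f (φ * φ)) (hφ : 0 < constantCoeff φ)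
    (hf0 : ∀ᶠ h in 𝓝[>] 0, 0 ≤ f h) : ExpandsTo N (fun h => √(f h)) φ := by
  have hT := tendsto_eval_trunc N φ
  have hsub : (fun h => f h - (trunc (N + 1) φ).eval h * (trunc (N + 1) φ).eval h)
      =O[𝓝[>] 0] fun h => h ^ (N + 1) := by
    refine (IsBigO.sub hf (isBigO_eval_trunc_mul N φ φ)).congr_left fun h => ?_
    ring
  refine IsBigO.trans (IsBigO.of_bound (constantCoeff φ / 2)⁻¹ ?_) hsub
  filter_upwards [hf0, hT.eventually_const_lt (half_lt_self hφ)] with h h0 hlt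
  set t := (trunc (N + 1) φ).eval h
  have hs := Real.sqrt_nonneg (f h)
  have hfac : f h - t * t = (√(f h) - t) * (√(f h) + t) := by
    linear_combination -(Real.mul_self_sqrt h0)
  rw [hfac, norm_mul, Real.norm_of_nonneg (by linarith : 0 ≤ √(f h) + t), ← div_eq_inv_mul,
    le_div_iff₀ (by positivity)]
  gcongr
  linarith

/-- An expansion to all orders at `0⁺` of a bounded function is uniform on `(0, 1]`. -/
lemma exists_bound_of_expandsTo (hf : ∀ N, ExpandsTo N f φ) {B : ℝ}
    (hB : ∀ h ∈ Set.Ioc (0 : ℝ) 1, |f h| ≤ B) (N : ℕ) :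
    ∃ C > 0, ∀ h ∈ Set.Ioc (0 : ℝ) 1,
      |f h - ∑ k ∈ Finset.range (N + 1), h ^ k * coeff k φ| ≤ C * h ^ (N + 1) := by
  obtain ⟨C₁, hC₁⟩ := (hf N).bound
  rw [eventually_nhdsWithin_iff, Metric.eventually_nhds_iff] at hC₁
  obtain ⟨δ, hδ, hC₁⟩ := hC₁
  set C₂ := B + ∑ k ∈ Finset.range (N + 1), |coeff k φ| with hC₂
  have hC₂0 : 0 ≤ C₂ :=
    add_nonneg ((abs_nonneg _).trans (hB 1 (by simp))) (Finset.sum_nonneg fun _ _ => abs_nonneg _)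
  refine ⟨|C₁| + C₂ / δ ^ (N + 1) + 1, by positivity, fun h hh => ?_⟩
  have hpos : 0 < h ^ (N + 1) := pow_pos hh.1 _
  rcases lt_or_ge h δ with hlt | hge
  · have := hC₁ (y := h) (by simpa [abs_of_pos hh.1] using hlt) hh.1
    rw [eval_trunc_eq_sum_range, Real.norm_eq_abs, Real.norm_of_nonneg hpos.le] at this
    refine this.trans ?_
    gcongr
    have := le_abs_self C₁
    have : 0 ≤ C₂ / δ ^ (N + 1) := by positivity
    linarith
  · have h1 : |f h - ∑ k ∈ Finset.range (N + 1), h ^ k * coeff k φ| ≤ C₂ := by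
      refine (abs_sub _ _).trans (add_le_add (hB h hh) ((Finset.abs_sum_le_sum_abs _ _).trans
        (Finset.sum_le_sum fun k _ => ?_)))
      rw [abs_mul, abs_of_nonneg (pow_nonneg hh.1.le k)]
      exact mul_le_of_le_one_left (abs_nonneg _) (pow_le_one₀ hh.1.le hh.2)
    have h2 : C₂ ≤ C₂ / δ ^ (N + 1) * h ^ (N + 1) := by
      rw [div_mul_eq_mul_div, le_div_iff₀ (by positivity)]
      gcongr
    have h3 : 0 ≤ (|C₁| + 1) * h ^ (N + 1) := by positivity
    linarith

lemma eventually_sum_range_nonneg (c : ℕ → ℝ) (i : ℕ) (hlt : ∀ j < i, c j = 0) (hi : 0 < c i)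
    (n : ℕ) : ∀ᶠ h in 𝓝[>] (0 : ℝ), 0 ≤ ∑ k ∈ Finset.range n, h ^ k * c k := by
  induction i generalizing c n with
  | zero =>
    rcases n with _ | n
    · simp
    have hcont : Continuous fun h : ℝ => ∑ k ∈ Finset.range (n + 1), h ^ k * c k := by fun_prop
    have := (hcont.tendsto 0).mono_left (nhdsWithin_le_nhds (s := Set.Ioi 0))
    rw [Finset.sum_range_succ'] at this
    simp only [ne_eq, Nat.add_eq_zero_iff, one_ne_zero, and_false, not_false_eq_true, zero_pow,
      zero_mul, Finset.sum_const_zero, pow_zero, one_mul, zero_add] at this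
    exact (this.eventually_const_lt hi).mono fun _ => le_of_lt
  | succ i ih =>
    rcases n with _ | n
    · simp
    filter_upwards [ih (fun k => c (k + 1)) (fun j hj => hlt _ (by lia)) hi n,
      self_mem_nhdsWithin] with h hh hpos
    rw [Finset.sum_range_succ', hlt 0 i.succ_pos, mul_zero, add_zero]
    simp only [pow_succ', mul_assoc, ← Finset.mul_sum]
    exact mul_nonneg (le_of_lt hpos) hh

lemma eventually_eval_trunc_le
    (hle : toLex (fun k => coeff k φ) ≤ toLex fun k => coeff k ψ) (n : ℕ) :
    ∀ᶠ h in 𝓝[>] (0 : ℝ), (trunc n φ).eval h ≤ (trunc n ψ).eval h := by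
  rcases hle.eq_or_lt with heq | ⟨i, hlt, hi⟩
  · have : φ = ψ := by
      ext k
      exact congrFun (toLex.injective heq) k
    simp [this]
  · have := eventually_sum_range_nonneg (fun k => coeff k ψ - coeff k φ) i
      (fun j hj => sub_eq_zero.mpr (hlt j hj).symm) (sub_pos.mpr hi) n
    filter_upwards [this] with h hh
    simp only [mul_sub, Finset.sum_sub_distrib, ← eval_trunc_eq_sum_range] at hh
    linarith

end Expansion

section EigenvalueComparison

lemma abs_dotProduct_mulVec_le {q : ℕ} {E : Matrix (Fin q) (Fin q) ℝ} {ε : ℝ}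
    (hE : ∀ i j, |E i j| ≤ ε) (c : Fin q → ℝ) :
    |c ⬝ᵥ E *ᵥ c| ≤ q * ε * (c ⬝ᵥ c) := by
  rcases isEmpty_or_nonempty (Fin q) with h | ⟨⟨i₀⟩⟩
  · simp [dotProduct]
  have hε : 0 ≤ ε := (abs_nonneg _).trans (hE i₀ i₀)
  have hcs : (∑ i, |c i|) ^ 2 ≤ q * ∑ i, c i * c i := by
    have := sq_sum_le_card_mul_sum_sq (s := Finset.univ) (f := fun i => |c i|)
    simpa [sq_abs, pow_two] using this
  calc |c ⬝ᵥ E *ᵥ c| = |∑ i, ∑ j, c i * (E i j * c j)| := by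
        simp only [dotProduct, Matrix.mulVec, Finset.mul_sum]
    _ ≤ ∑ i, ∑ j, |c i * (E i j * c j)| :=
        (Finset.abs_sum_le_sum_abs _ _).trans
          (Finset.sum_le_sum fun i _ => Finset.abs_sum_le_sum_abs _ _)
    _ ≤ ∑ i, ∑ j, ε * (|c i| * |c j|) := by
        refine Finset.sum_le_sum fun i _ => Finset.sum_le_sum fun j _ => ?_
        rw [abs_mul, abs_mul, mul_left_comm]
        exact mul_le_mul_of_nonneg_right (hE i j) (by positivity)
    _ = ε * (∑ i, |c i|) ^ 2 := by
        rw [pow_two, Finset.sum_mul_sum]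
        simp only [Finset.mul_sum]
    _ ≤ ε * (q * ∑ i, c i * c i) := by gcongr
    _ = q * ε * (c ⬝ᵥ c) := by rw [dotProduct]; ring

/-- A nonzero vector supported on the first `n + 1` coordinates which `u` maps to a vector
supported away from the first `n` coordinates. -/
lemma exists_mulVec_eq_zero_of_lt {q : ℕ} (u : Matrix (Fin q) (Fin q) ℝ) (n : Fin q) :
    ∃ c : Fin q → ℝ, c ≠ 0 ∧ (∀ i, n < i → c i = 0) ∧ ∀ k < n, (u *ᵥ c) k = 0 := by
  set B : Matrix (Fin q) (Fin q) ℝ :=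
    Matrix.of fun k => if k < n then u k else if n < k then Pi.single k 1 else 0 with hB
  obtain ⟨c, hc, hBc⟩ := Matrix.exists_mulVec_eq_zero_iff.mpr
    (Matrix.det_eq_zero_of_row_eq_zero (A := B) n fun j => by simp [hB])
  refine ⟨c, hc, fun i hi => ?_, fun k hk => ?_⟩
  · have := congrFun hBc i
    simpa [hB, Matrix.mulVec, hi, hi.not_gt] using this
  · have := congrFun hBc k
    simpa [hB, Matrix.mulVec, hk] using this

/-- Comparison of the ordered eigenvalues `lam` with approximate eigenvalues `d` obtained from an
approximately orthogonal change of basis `u`. -/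
lemma eigenvalue_le_add {q : ℕ} {u : Matrix (Fin q) (Fin q) ℝ} {lam d : Fin q → ℝ}
    (hlam : Monotone lam) (hd : Monotone d) {ε : ℝ} (h1 : ∀ i j, |(uᵀ * u - 1) i j| ≤ ε)
    (h2 : ∀ i j, |(uᵀ * diagonal lam * u - diagonal d) i j| ≤ ε) (n : Fin q) :
    lam n ≤ d n + q * ε * (1 + |lam n|) := by
  obtain ⟨c, hc, hsupp, huc⟩ := exists_mulVec_eq_zero_of_lt u n
  have hcc : 0 < c ⬝ᵥ c := by
    refine lt_of_le_of_ne (Finset.sum_nonneg fun i _ => mul_self_nonneg _) fun h => hc ?_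
    exact dotProduct_self_eq_zero.mp h.symm
  set y := u *ᵥ c with hy
  have e1 : c ⬝ᵥ (uᵀ * u - 1) *ᵥ c = y ⬝ᵥ y - c ⬝ᵥ c := by
    rw [Matrix.sub_mulVec, dotProduct_sub, Matrix.one_mulVec, ← Matrix.mulVec_mulVec,
      Matrix.dotProduct_mulVec, Matrix.vecMul_transpose]
  have e2 : c ⬝ᵥ (uᵀ * diagonal lam * u - diagonal d) *ᵥ c =
      ∑ k, lam k * (y k * y k) - ∑ k, d k * (c k * c k) := by
    rw [Matrix.sub_mulVec, dotProduct_sub, Matrix.mul_assoc, ← Matrix.mulVec_mulVec,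
      Matrix.dotProduct_mulVec, Matrix.vecMul_transpose, ← Matrix.mulVec_mulVec]
    simp only [dotProduct, Matrix.mulVec_diagonal, ← hy, mul_left_comm]
  have b1 := abs_le.mp (e1 ▸ abs_dotProduct_mulVec_le h1 c)
  have b2 := abs_le.mp (e2 ▸ abs_dotProduct_mulVec_le h2 c)
  have l1 : lam n * (y ⬝ᵥ y) ≤ ∑ k, lam k * (y k * y k) := by
    rw [dotProduct, Finset.mul_sum]
    refine Finset.sum_le_sum fun k _ => ?_
    rcases lt_or_ge k n with hk | hk
    · simp [huc k hk]
    · exact mul_le_mul_of_nonneg_right (hlam hk) (mul_self_nonneg _)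
  have l2 : ∑ k, d k * (c k * c k) ≤ d n * (c ⬝ᵥ c) := by
    rw [dotProduct, Finset.mul_sum]
    refine Finset.sum_le_sum fun k _ => ?_
    rcases lt_or_ge n k with hk | hk
    · simp [hsupp k hk]
    · exact mul_le_mul_of_nonneg_right (hd hk) (mul_self_nonneg _)
  have l3 : -(|lam n| * (q * ε * (c ⬝ᵥ c))) ≤ lam n * (y ⬝ᵥ y - c ⬝ᵥ c) := by
    refine (abs_le.mp ?_).1
    rw [abs_mul]
    exact mul_le_mul_of_nonneg_left (abs_le.mpr b1) (abs_nonneg _)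
  refine le_of_mul_le_mul_right ?_ hcc
  linarith [b2.2]

lemma abs_eigenvalue_sub_le {q : ℕ} {u : Matrix (Fin q) (Fin q) ℝ} {lam d : Fin q → ℝ}
    (hlam : Monotone lam) (hd : Monotone d) {ε : ℝ} (h1 : ∀ i j, |(uᵀ * u - 1) i j| ≤ ε)
    (h2 : ∀ i j, |(uᵀ * diagonal lam * u - diagonal d) i j| ≤ ε) (n : Fin q) :
    |lam n - d n| ≤ q * ε * (1 + |lam n|) := by
  have hup := eigenvalue_le_add hlam hd h1 h2 n
  set r : Fin q ≃ Fin q := Fin.revPerm with hr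
  have hu : ((u.submatrix r r)ᵀ * u.submatrix r r) = (uᵀ * u).submatrix r r := by
    rw [Matrix.transpose_submatrix, Matrix.submatrix_mul_equiv]
  have hdiag (f : Fin q → ℝ) : diagonal (fun i => -f (r i)) = -(diagonal f).submatrix r r := by
    rw [Matrix.submatrix_diagonal_equiv, Matrix.diagonal_neg]
    rfl
  have hlow := eigenvalue_le_add (u := u.submatrix r r) (lam := fun i => -lam (r i))
    (d := fun i => -d (r i)) (ε := ε)
    (fun i j hij => neg_le_neg (hlam (Fin.rev_le_rev.mpr hij)))
    (fun i j hij => neg_le_neg (hd (Fin.rev_le_rev.mpr hij)))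
    (fun i j => by
      have := h1 (r i) (r j)
      rw [hu, ← Matrix.submatrix_one_equiv r]
      exact this)
    (fun i j => by
      have := h2 (r i) (r j)
      rw [← abs_neg] at this
      rw [hdiag lam, hdiag d, Matrix.transpose_submatrix, Matrix.mul_neg, Matrix.neg_mul,
        Matrix.submatrix_mul_equiv, Matrix.submatrix_mul_equiv]
      refine le_of_eq_of_le (congrArg abs ?_) this
      simp only [Matrix.sub_apply, Matrix.neg_apply, Matrix.submatrix_apply]
      ring) (r n)
  have hrr : r (r n) = n := Fin.rev_rev n
  simp only [hrr, abs_neg] at hlow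
  rw [abs_le]
  constructor <;> linarith

lemma exists_orthogonal_diagonal_monotone {q : ℕ} (A : Matrix (Fin q) (Fin q) ℝ) (hA : Aᵀ = A) :
    ∃ (V : Matrix (Fin q) (Fin q) ℝ) (lam : Fin q → ℝ),
      Vᵀ * V = 1 ∧ Vᵀ * A * V = diagonal lam ∧ Monotone lam := by
  obtain ⟨U, d, hU, hd⟩ := exists_orthogonal_diagonal A hA
  set σ := Tuple.sort d
  refine ⟨U.submatrix id σ, d ∘ σ, ?_, ?_, Tuple.monotone_sort d⟩
  · rw [Matrix.transpose_submatrix, ← Matrix.submatrix_mul _ _ _ _ _ Function.bijective_id, hU,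
      Matrix.submatrix_one_equiv]
  · rw [← Matrix.submatrix_diagonal_equiv, ← hd, Matrix.transpose_submatrix]
    ext i j
    simp [Matrix.mul_apply]

lemma roots_charpoly_of_orthogonal {n : Type*} [Fintype n] [DecidableEq n]
    {A U : Matrix n n ℝ} {d : n → ℝ} (hU : Uᵀ * U = 1) (hd : Uᵀ * A * U = diagonal d) :
    A.charpoly.roots = Multiset.map d Finset.univ.val := by
  have : A.charpoly = (diagonal d).charpoly := by
    rw [← hd, Matrix.charpoly_mul_comm, ← Matrix.mul_assoc, mul_eq_one_comm.mp hU, Matrix.one_mul]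
  rw [this, Matrix.charpoly_diagonal]
  exact Polynomial.roots_multiset_prod_X_sub_C (Multiset.map d Finset.univ.val) ▸ by simp

/-- The eigenvalues of `Aᵀ * A` are nonnegative and bounded by the sum of the squared entries of
`A`. -/
lemma nonneg_and_le_of_conj {p q : ℕ} {A : Matrix (Fin p) (Fin q) ℝ}
    {V : Matrix (Fin q) (Fin q) ℝ} {lam : Fin q → ℝ} (hV : Vᵀ * V = 1)
    (hd : Vᵀ * (Aᵀ * A) * V = diagonal lam) (n : Fin q) :
    0 ≤ lam n ∧ lam n ≤ ∑ i, ∑ j, A j i * A j i := by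
  have hnonneg (n : Fin q) : 0 ≤ lam n := by
    have h : Vᵀ * (Aᵀ * A) * V = (A * V)ᵀ * (A * V) := by
      simp only [Matrix.transpose_mul, Matrix.mul_assoc]
    have := congrFun (congrFun (h ▸ hd) n) n
    rw [Matrix.diagonal_apply_eq, Matrix.mul_apply] at this
    rw [← this]
    exact Finset.sum_nonneg fun k _ => mul_self_nonneg _
  refine ⟨hnonneg n, ?_⟩
  calc lam n ≤ ∑ k, lam k := Finset.single_le_sum (fun k _ => hnonneg k) (Finset.mem_univ n)
    _ = (Vᵀ * (Aᵀ * A) * V).trace := by rw [hd, Matrix.trace_diagonal]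
    _ = (Aᵀ * A).trace := by
      rw [Matrix.trace_mul_comm, ← Matrix.mul_assoc, mul_eq_one_comm.mp hV, Matrix.one_mul]
    _ = ∑ i, ∑ j, A j i * A j i := by simp [Matrix.trace, Matrix.mul_apply]

end EigenvalueComparison

section Main

open Filter Topology Asymptotics

/-- The formal spectral theorem with lexicographically ordered eigenvalues. -/
lemma exists_orthogonal_diagonal_lex {q : ℕ} (S : Matrix (Fin q) (Fin q) ℝ⟦X⟧) (hS : Sᵀ = S) :
    ∃ (W : Matrix (Fin q) (Fin q) ℝ⟦X⟧) (D : Fin q → ℝ⟦X⟧), Wᵀ * W = 1 ∧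
      Wᵀ * S * W = diagonal D ∧ Monotone fun n => toLex fun k => coeff k (D n) := by
  obtain ⟨W, D, hW, hD⟩ := orthDiag_of_symm S hS
  set f : Fin q → Lex (ℕ → ℝ) := fun n => toLex fun k => coeff k (D n)
  set σ := Tuple.sort f
  refine ⟨W.submatrix id σ, D ∘ σ, ?_, ?_, Tuple.monotone_sort f⟩
  · rw [Matrix.transpose_submatrix, ← Matrix.submatrix_mul _ _ _ _ _ Function.bijective_id, hW,
      Matrix.submatrix_one_equiv]
  · rw [← Matrix.submatrix_diagonal_equiv, ← hD, Matrix.transpose_submatrix]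
    ext1 i j
    simp [Matrix.mul_apply]

lemma constantCoeff_monotone {q : ℕ} {D : Fin q → ℝ⟦X⟧}
    (hD : Monotone fun n => toLex fun k => coeff k (D n)) :
    Monotone fun n => constantCoeff (D n) := by
  intro i j hij
  simp only [← PowerSeries.coeff_zero_eq_constantCoeff_apply]
  rcases (hD hij).eq_or_lt with heq | ⟨k, hlt, hk⟩
  · exact (congrFun (toLex.injective heq) 0).le
  · rcases k with _ | k
    · exact hk.le
    · exact (hlt 0 k.succ_pos).le

/-- If a power series matrix diagonalizing the expansion of `M` is given, then the ordered
eigenvalues of `M` expand to the lexicographically ordered formal eigenvalues. -/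
lemma expandsTo_eigenvalue {q N : ℕ} {M V : ℝ → Matrix (Fin q) (Fin q) ℝ} {lam : ℝ → Fin q → ℝ}
    {S W : Matrix (Fin q) (Fin q) ℝ⟦X⟧} {D : Fin q → ℝ⟦X⟧}
    (hM : ∀ i j, ExpandsTo N (fun h => M h i j) (S i j))
    (hV : ∀ h, (V h)ᵀ * V h = 1) (hVM : ∀ h, (V h)ᵀ * M h * V h = diagonal (lam h))
    (hlam : ∀ h, Monotone (lam h)) (hbdd : ∀ n, (fun h => lam h n) =O[𝓝[>] 0] fun _ => (1 : ℝ))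
    (hW : Wᵀ * W = 1) (hWS : Wᵀ * S * W = diagonal D)
    (hD : Monotone fun n => toLex fun k => coeff k (D n)) (n : Fin q) :
    ExpandsTo N (fun h => lam h n) (D n) := by
  set w : ℝ → Matrix (Fin q) (Fin q) ℝ :=
    fun h => Matrix.of fun i j => (trunc (N + 1) (W i j)).eval h with hw
  have hwW (i j : Fin q) : ExpandsTo N (fun h => w h i j) (W i j) := ExpandsTo.eval_trunc N _
  have hww := ExpandsTo.matrix_mul (A := fun h => (w h)ᵀ) (A' := Wᵀ) (fun i j => hwW j i) hwW
  have hwMw := ExpandsTo.matrix_mul (ExpandsTo.matrix_mul (A := fun h => (w h)ᵀ) (A' := Wᵀ)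
    (fun i j => hwW j i) hM) hwW
  rw [hW] at hww
  rw [hWS] at hwMw
  set d : ℝ → Fin q → ℝ := fun h n => (trunc (N + 1) (D n)).eval h with hd
  set E₁ : ℝ → Matrix (Fin q) (Fin q) ℝ := fun h => (w h)ᵀ * w h - 1 with hE₁
  set E₂ : ℝ → Matrix (Fin q) (Fin q) ℝ := fun h => (w h)ᵀ * M h * w h - diagonal (d h) with hE₂
  have hE₁O (i j : Fin q) : (fun h => E₁ h i j) =O[𝓝[>] 0] fun h => h ^ (N + 1) := by
    refine IsBigO.congr_left (hww i j) fun h => ?_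
    by_cases hij : i = j <;> simp [hE₁, hij, Matrix.one_apply]
  have hE₂O (i j : Fin q) : (fun h => E₂ h i j) =O[𝓝[>] 0] fun h => h ^ (N + 1) := by
    refine IsBigO.congr_left (hwMw i j) fun h => ?_
    by_cases hij : i = j <;> simp [hE₂, hd, hij]
  set ε : ℝ → ℝ := fun h => ∑ i, ∑ j, (|E₁ h i j| + |E₂ h i j|) with hε
  have hεO : ε =O[𝓝[>] 0] fun h => h ^ (N + 1) := by
    refine IsBigO.fun_sum fun i _ => IsBigO.fun_sum fun j _ => ?_
    exact (hE₁O i j).abs_left.add (hE₂O i j).abs_left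
  have hle (h : ℝ) (i j : Fin q) : |E₁ h i j| + |E₂ h i j| ≤ ε h :=
    (Finset.single_le_sum (f := fun j => |E₁ h i j| + |E₂ h i j|) (fun _ _ => by positivity)
      (Finset.mem_univ j)).trans
      (Finset.single_le_sum (f := fun i => ∑ j, (|E₁ h i j| + |E₂ h i j|))
        (fun _ _ => by positivity) (Finset.mem_univ i))
  have hdmono : ∀ᶠ h in 𝓝[>] (0 : ℝ), Monotone (d h) := by
    have : ∀ᶠ h in 𝓝[>] (0 : ℝ), ∀ i j : Fin q, i ≤ j → d h i ≤ d h j := by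
      simp only [eventually_all]
      exact fun i j hij => eventually_eval_trunc_le (hD hij) (N + 1)
    exact this
  have hbound : ∀ᶠ h in 𝓝[>] (0 : ℝ), ‖lam h n - d h n‖ ≤ ‖q * ε h * (1 + |lam h n|)‖ := by
    filter_upwards [hdmono] with h hmono
    have hVV := mul_eq_one_comm.mp (hV h)
    refine (abs_eigenvalue_sub_le (u := (V h)ᵀ * w h) (hlam h) hmono (ε := ε h)
      (fun i j => ?_) (fun i j => ?_) n).trans (le_abs_self _)
    · have : ((V h)ᵀ * w h)ᵀ * ((V h)ᵀ * w h) = (w h)ᵀ * ((V h * (V h)ᵀ) * w h) := by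
        simp only [Matrix.transpose_mul, Matrix.transpose_transpose, Matrix.mul_assoc]
      rw [this, hVV, Matrix.one_mul]
      exact (le_add_of_nonneg_right (abs_nonneg _)).trans (hle h i j)
    · have : ((V h)ᵀ * w h)ᵀ * diagonal (lam h) * ((V h)ᵀ * w h) =
          (w h)ᵀ * ((V h * (V h)ᵀ) * M h * (V h * (V h)ᵀ)) * w h := by
        rw [← hVM]
        simp only [Matrix.transpose_mul, Matrix.transpose_transpose, Matrix.mul_assoc]
      rw [this, hVV, Matrix.one_mul, Matrix.mul_one]
      exact (le_add_of_nonneg_left (abs_nonneg _)).trans (hle h i j)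
  have hO : (fun h => q * ε h * (1 + |lam h n|)) =O[𝓝[>] 0] fun h => h ^ (N + 1) := by
    refine ((hεO.const_mul_left (q : ℝ)).mul
      ((isBigO_refl (fun _ => (1 : ℝ)) _).add (hbdd n).abs_left)).congr_right fun h => mul_one _
  exact (IsBigO.of_bound' hbound).trans hO

lemma expandsTo_entry {p q : ℕ} {A : ℝ → Matrix (Fin p) (Fin q) ℝ}
    {Ak : ℕ → Matrix (Fin p) (Fin q) ℝ} {N : ℕ} {C : ℝ}
    (hexp : ∀ h ∈ Set.Ioc (0 : ℝ) 1,
      ‖A h - ∑ k ∈ Finset.range (N + 1), h ^ k • Ak k‖ ≤ C * h ^ (N + 1)) (i : Fin p) (j : Fin q) :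
    ExpandsTo N (fun h => A h i j) (PowerSeries.mk fun k => Ak k i j) := by
  refine IsBigO.of_bound C ?_
  filter_upwards [Ioc_mem_nhdsGT (zero_lt_one' ℝ)] with h hh
  have := (Matrix.norm_entry_le_entrywise_sup_norm _ (i := i) (j := j)).trans (hexp h hh)
  rw [Real.norm_of_nonneg (pow_nonneg hh.1.le _)]
  simpa [eval_trunc_eq_sum_range, Matrix.sum_apply] using this

lemma exists_entry_bound {p q : ℕ} {A : ℝ → Matrix (Fin p) (Fin q) ℝ}
    {A₀ : Matrix (Fin p) (Fin q) ℝ} {C : ℝ} (hC : 0 < C)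
    (hA : ∀ h ∈ Set.Ioc (0 : ℝ) 1, ‖A h - A₀‖ ≤ C * h) :
    ∃ B, ∀ h ∈ Set.Ioc (0 : ℝ) 1, ∑ i, ∑ j, A h j i * A h j i ≤ B := by
  refine ⟨∑ _i : Fin q, ∑ _j : Fin p, (C + ‖A₀‖) * (C + ‖A₀‖), fun h hh => ?_⟩
  refine Finset.sum_le_sum fun i _ => Finset.sum_le_sum fun j _ => ?_
  have h1 : ‖A h‖ ≤ C + ‖A₀‖ := by
    calc ‖A h‖ = ‖(A h - A₀) + A₀‖ := by rw [sub_add_cancel]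
      _ ≤ ‖A h - A₀‖ + ‖A₀‖ := norm_add_le _ _
      _ ≤ C + ‖A₀‖ := by
        gcongr
        exact (hA h hh).trans (mul_le_of_le_one_right hC.le hh.2)
  have h2 : |A h j i| ≤ C + ‖A₀‖ := (Matrix.norm_entry_le_entrywise_sup_norm _).trans h1
  rw [← abs_mul_abs_self]
  exact mul_self_le_mul_self (abs_nonneg _) h2

lemma diagonal_pos_of_posDef {n : Type*} [Fintype n] [DecidableEq n] {M U : Matrix n n ℝ}
    {d : n → ℝ} (hM : M.PosDef) (hU : Uᵀ * U = 1) (hd : Uᵀ * M * U = diagonal d) (i : n) :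
    0 < d i := by
  have hinj : Function.Injective U.mulVec :=
    Matrix.mulVec_injective_of_isUnit (IsUnit.of_mul_eq_one_right _ hU)
  have := hM.conjTranspose_mul_mul_same hinj
  rw [Matrix.conjTranspose_eq_transpose_of_trivial, hd] at this
  exact Matrix.posDef_diagonal_iff.mp this i

end Main

end PowerSeriesMatrix

open PowerSeries PowerSeriesMatrix Filter Topology Asymptotics in
/-- **Classical expansions of singular values.**  Let `p ≥ q ≥ 1` and let `A(h)`, `h ∈ (0,1]`,
be real `p × q` matrices with a classical expansion `A(h) ∼ Σ hᵏ Aₖ` such that all singular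
values of `A₀` are nonzero (i.e. `A₀ᵀ A₀` is positive definite).  Then, for `h` small, the
`n`-th smallest singular value `μₙ(h)` of `A(h)` admits a classical expansion whose leading
term is the `n`-th smallest singular value of `A₀`.  (The `n`-th smallest singular values are
encoded by monotone nonnegative enumerations whose squares are the eigenvalues of `AᵀA`,
counted with multiplicity.) -/
theorem singular_values_classical_expansion
    (p q : ℕ) (hq : 1 ≤ q) (hpq : q ≤ p)
    (A : ℝ → Matrix (Fin p) (Fin q) ℝ)
    (Ak : ℕ → Matrix (Fin p) (Fin q) ℝ)
    (hexp : ∀ N : ℕ, ∃ C > 0, ∀ h ∈ Set.Ioc (0 : ℝ) 1,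
      ‖A h - ∑ k ∈ Finset.range (N + 1), h ^ k • Ak k‖ ≤ C * h ^ (N + 1))
    (hA0 : ((Ak 0)ᵀ * Ak 0).PosDef) :
    ∃ h₁, 0 < h₁ ∧ h₁ ≤ 1 ∧
      ∃ (μ : Fin q → ℝ → ℝ) (μ0 : Fin q → ℝ),
        Monotone μ0 ∧ (∀ n, 0 ≤ μ0 n) ∧
        ((Ak 0)ᵀ * Ak 0).charpoly.roots =
          Multiset.map (fun n : Fin q => μ0 n ^ 2) Finset.univ.val ∧
        (∀ h ∈ Set.Ioc (0 : ℝ) h₁,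
          Monotone (fun n => μ n h) ∧ (∀ n, 0 ≤ μ n h) ∧
          ((A h)ᵀ * A h).charpoly.roots =
            Multiset.map (fun n : Fin q => μ n h ^ 2) Finset.univ.val) ∧
        (∀ n : Fin q, ∃ a : ℕ → ℝ, a 0 = μ0 n ∧
          ∀ N : ℕ, ∃ C > 0, ∀ h ∈ Set.Ioc (0 : ℝ) h₁,
            |μ n h - ∑ k ∈ Finset.range (N + 1), h ^ k * a k| ≤ C * h ^ (N + 1)) := by
  set a : Matrix (Fin p) (Fin q) ℝ⟦X⟧ := Matrix.of fun i j => PowerSeries.mk fun k => Ak k i j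
    with ha
  have haA (N : ℕ) (i : Fin p) (j : Fin q) : ExpandsTo N (fun h => A h i j) (a i j) := by
    obtain ⟨C, -, hC⟩ := hexp N
    exact expandsTo_entry hC i j
  obtain ⟨B, hB⟩ : ∃ B, ∀ h ∈ Set.Ioc (0 : ℝ) 1, ∑ i, ∑ j, A h j i * A h j i ≤ B := by
    obtain ⟨C, hC, hC'⟩ := hexp 0
    exact exists_entry_bound (A₀ := Ak 0) hC fun h hh => by simpa using hC' h hh
  obtain ⟨W, D, hW, hWD, hD⟩ := exists_orthogonal_diagonal_lex (aᵀ * a) (by simp)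
  choose V lam hV hVM hlam using fun h =>
    exists_orthogonal_diagonal_monotone ((A h)ᵀ * A h) (by simp)
  have hlam0 (h : ℝ) (n : Fin q) : 0 ≤ lam h n := (nonneg_and_le_of_conj (hV h) (hVM h) n).1
  have hlamB (h : ℝ) (hh : h ∈ Set.Ioc (0 : ℝ) 1) (n : Fin q) : lam h n ≤ B :=
    (nonneg_and_le_of_conj (hV h) (hVM h) n).2.trans (hB h hh)
  have hlamO (n : Fin q) : (fun h => lam h n) =O[𝓝[>] 0] fun _ => (1 : ℝ) := by
    refine IsBigO.of_bound B ?_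
    filter_upwards [Ioc_mem_nhdsGT (zero_lt_one' ℝ)] with h hh
    simpa [abs_of_nonneg (hlam0 h n)] using hlamB h hh n
  have hexpand (N : ℕ) (n : Fin q) : ExpandsTo N (fun h => lam h n) (D n) :=
    expandsTo_eigenvalue (M := fun h => (A h)ᵀ * A h)
      (ExpandsTo.matrix_mul (A := fun h => (A h)ᵀ) (A' := aᵀ) (fun i j => haA N j i) (haA N))
      hV hVM hlam hlamO hW hWD hD n
  set W₀ := W.map constantCoeff
  have ha₀ : a.map constantCoeff = Ak 0 := by
    ext i j
    simp [ha]
  have hW₀ : W₀ᵀ * W₀ = 1 := by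
    have := congrArg (fun M => M.map constantCoeff) hW
    rwa [Matrix.map_mul, Matrix.map_one _ (map_zero _) (map_one _)] at this
  have hWD₀ : W₀ᵀ * ((Ak 0)ᵀ * Ak 0) * W₀ = diagonal fun n => constantCoeff (D n) := by
    have := congrArg (fun M => M.map constantCoeff) hWD
    rw [Matrix.map_mul, Matrix.map_mul, Matrix.map_mul, Matrix.diagonal_map (map_zero _)] at this
    rw [← ha₀]
    exact this
  choose e he he0 using fun n => exists_sq_eq (D n) (diagonal_pos_of_posDef hA0 hW₀ hWD₀ n)
  have he₀ (n : Fin q) : constantCoeff (e n) ^ 2 = constantCoeff (D n) := by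
    rw [pow_two, ← map_mul, he]
  refine ⟨1, one_pos, le_rfl, fun n h => √(lam h n), fun n => constantCoeff (e n), ?_,
    fun n => (he0 n).le, ?_, fun h _ => ⟨fun i j hij => Real.sqrt_le_sqrt (hlam h hij),
      fun n => Real.sqrt_nonneg _, ?_⟩, fun n => ⟨fun k => coeff k (e n), ?_, ?_⟩⟩
  · intro i j hij
    refine (pow_le_pow_iff_left₀ (he0 i).le (he0 j).le two_ne_zero).mp ?_
    simp only [he₀]
    exact constantCoeff_monotone hD hij
  · simp only [he₀]
    exact roots_charpoly_of_orthogonal hW₀ hWD₀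
  · simp only [Real.sq_sqrt (hlam0 h _)]
    exact roots_charpoly_of_orthogonal (hV h) (hVM h)
  · exact PowerSeries.coeff_zero_eq_constantCoeff_apply _
  · refine exists_bound_of_expandsTo (B := √B) (fun N => ?_) fun h hh => ?_
    · exact ExpandsTo.sqrt (by rw [he]; exact hexpand N n) (he0 n)
        (Eventually.of_forall fun h => hlam0 h n)
    · rw [abs_of_nonneg (Real.sqrt_nonneg _)]
      exact Real.sqrt_le_sqrt (hlamB h hh n)
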